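/- There exists a binary linear [41, 6, 18] self-orthogonal code: an F_2-subspace C of F_2^41 with dim C = 6, such that x·y = 0 for all x, y ∈ C, every nonzero codeword of C has Hamming weight at least 18, and some codeword of C has Hamming weight exactly 18. -/

import Mathlib

/-- The columns of the generator matrix, written as 6-bit numbers. -/
def genCols : List ℕ :=
  [2,51,37,7,20,17,54,3,50,36,6,21,16,55,4,38,53,48,23,35,18,8,27,30,57,13,60,42,11,41,58,63,24,
    44,29,15,46,46,46,47,47]

/-- The generator matrix of the code. -/
def genMat : Matrix (Fin 6) (Fin 41) (ZMod 2) :=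
  fun i j => if (genCols.getD j.val 0).testBit i.val then 1 else 0

theorem genMat_gram : genMat * genMat.transpose = 0 := by
  have h : ∀ i k : Fin 6, ∑ j, genMat i j * genMat k j = 0 := by decide +kernel
  ext i k
  simpa [Matrix.mul_apply] using h i k

theorem genMat_weight (u : Fin 6 → ZMod 2) :
    u = 0 ∨ 18 ≤ hammingNorm (Matrix.vecMul u genMat) := by
  have h : ∀ u : Fin 6 → ZMod 2,
      u = 0 ∨ 18 ≤ hammingNorm (fun j => ∑ i, u i * genMat i j) := by decide +kernel
  exact h u

theorem genMat_attained :
    hammingNorm (Matrix.vecMul ![0, 1, 0, 0, 0, 1] genMat) = 18 := by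
  have h : hammingNorm
      (fun j => ∑ i, (![0, 1, 0, 0, 0, 1] : Fin 6 → ZMod 2) i * genMat i j) = 18 := by
    decide +kernel
  exact h

/-- There exists a binary linear [41, 6, 18] self-orthogonal code. -/
theorem stmt_15 :
    ∃ C : Submodule (ZMod 2) (Fin 41 → ZMod 2),
      Module.finrank (ZMod 2) C = 6 ∧
      (∀ x ∈ C, ∀ y ∈ C, ∑ j, x j * y j = (0 : ZMod 2)) ∧
      (∀ x ∈ C, x ≠ 0 → 18 ≤ hammingNorm x) ∧
      (∃ x ∈ C, hammingNorm x = 18) := by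
  refine ⟨LinearMap.range genMat.vecMulLinear, ?_, ?_, ?_, ?_⟩
  · rw [LinearMap.finrank_range_of_inj]
    · simp
    · rw [injective_iff_map_eq_zero]
      intro u hu
      rcases genMat_weight u with h | h
      · exact h
      · have hu' : Matrix.vecMul u genMat = 0 := hu
        rw [hu'] at h
        simp at h
  · rintro _ ⟨u, rfl⟩ _ ⟨v, rfl⟩
    change Matrix.vecMul u genMat ⬝ᵥ Matrix.vecMul v genMat = 0
    rw [← Matrix.mulVec_transpose genMat v, Matrix.dotProduct_mulVec, Matrix.vecMul_vecMul,
      genMat_gram]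
    simp
  · rintro _ ⟨u, rfl⟩ hne
    rcases genMat_weight u with h | h
    · subst h
      simp at hne
    · exact h
  · exact ⟨_, ⟨![0, 1, 0, 0, 0, 1], rfl⟩, genMat_attained⟩
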